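/- Let τ lie in the upper half-plane and set q = e^{2πiτ}. With η(τ) = q^{1/24} Π_{n=1}^{∞} (1 − q^n) the Dedekind eta function and Φ_3^{(a)}(τ) = Σ_{n∈ℤ} n χ_6^{(a)}(n) e^{π i n² τ/6} for a = 0, 1, the following eta-product identities hold: Φ_3^{(0)}(τ) = 4 ( η(τ) η(4τ) )² / η(2τ) and Φ_3^{(1)}(τ) = 2 η(2τ)^5 / η(4τ)². -/

import Mathlib

open scoped Real BigOperators
open Complex (I)

/-- The odd periodic function `χ_{2m}^{(a)} : ℤ → ℂ` with period `2m`, taking the value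
`+1` at `n ≡ m−1−a (mod 2m)`, `−1` at `n ≡ m+1+a (mod 2m)`, and `0` otherwise. -/
def chi (m a : ℕ) (n : ℤ) : ℂ :=
  if (n : ZMod (2 * m)) = ((m - 1 - a : ℕ) : ZMod (2 * m)) then 1
  else if (n : ZMod (2 * m)) = ((m + 1 + a : ℕ) : ZMod (2 * m)) then -1
  else 0

/-- The weight-`3/2` theta series
`Φ_m^{(a)}(τ) = Σ_{n∈ℤ} n χ_{2m}^{(a)}(n) e^{πin²τ/(2m)}` (for `Im τ > 0`). -/
noncomputable def Phi (m a : ℕ) (τ : ℂ) : ℂ :=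
  ∑' n : ℤ, (n : ℂ) * chi m a n * Complex.exp ((π : ℂ) * I * (n : ℂ) ^ 2 * τ / (2 * m))

/-- The Dedekind eta function `η(τ) = q^{1/24} Π_{n=1}^{∞} (1 − q^n)`, `q = e^{2πiτ}`,
`Im τ > 0` (here `q^{1/24} = e^{πiτ/12}`). -/
noncomputable def dedekindEta (τ : ℂ) : ℂ :=
  Complex.exp ((π : ℂ) * I * τ / 12) *
    ∏' n : ℕ, (1 - Complex.exp (2 * (π : ℂ) * I * τ) ^ (n + 1))

open Filter Topology

/-- The finite product `(q; q)_n`. -/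
noncomputable def qFactorial (q : ℂ) (n : ℕ) : ℂ := ∏ k ∈ Finset.range n, (1 - q ^ (k + 1))

/-- The Gaussian binomial coefficient. -/
noncomputable def qBinomial (q : ℂ) (n k : ℕ) : ℂ :=
  if k ≤ n then qFactorial q n / (qFactorial q k * qFactorial q (n - k)) else 0

/-- Euler's product `∏ (1 - q ^ n)`. -/
noncomputable def eulerProd (q : ℂ) : ℂ := ∏' n : ℕ, (1 - q ^ (n + 1))

lemma one_sub_pow_ne_zero {q : ℂ} (hq : ‖q‖ < 1) (n : ℕ) : 1 - q ^ (n + 1) ≠ 0 := by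
  intro h
  have h1 : q ^ (n + 1) = 1 := (sub_eq_zero.mp h).symm
  have h2 : ‖q‖ ^ (n + 1) = 1 := by rw [← norm_pow, h1, norm_one]
  exact absurd h2 (pow_lt_one₀ (norm_nonneg _) hq (Nat.succ_ne_zero n)).ne

lemma qFactorial_ne_zero {q : ℂ} (hq : ‖q‖ < 1) (n : ℕ) : qFactorial q n ≠ 0 :=
  Finset.prod_ne_zero_iff.mpr fun k _ => one_sub_pow_ne_zero hq k

lemma qFactorial_succ (q : ℂ) (n : ℕ) :
    qFactorial q (n + 1) = qFactorial q n * (1 - q ^ (n + 1)) :=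
  Finset.prod_range_succ _ _

lemma qFactorial_zero (q : ℂ) : qFactorial q 0 = 1 := Finset.prod_range_zero _

lemma qBinomial_zero_right {q : ℂ} (hq : ‖q‖ < 1) (n : ℕ) : qBinomial q n 0 = 1 := by
  simp [qBinomial, qFactorial_zero, qFactorial_ne_zero hq n]

lemma qBinomial_self_succ (q : ℂ) (n : ℕ) : qBinomial q n (n + 1) = 0 := by
  simp [qBinomial]

lemma qBinomial_succ_succ {q : ℂ} (hq : ‖q‖ < 1) {n k : ℕ} (hk : k ≤ n) :
    qBinomial q (n + 1) (k + 1) = qBinomial q n (k + 1) + q ^ (n - k) * qBinomial q n k := by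
  obtain ⟨d, rfl⟩ := Nat.exists_eq_add_of_le hk
  have h := qFactorial_ne_zero hq
  rcases d with _ | d
  · simp [qBinomial, qFactorial_zero, h]
  · have e1 : k + (d + 1) + 1 - (k + 1) = d + 1 := by omega
    have e2 : k + (d + 1) - (k + 1) = d := by omega
    have e3 : k + (d + 1) - k = d + 1 := by omega
    have e4 : k + 1 ≤ k + (d + 1) := by omega
    have e5 : k + 1 ≤ k + (d + 1) + 1 := by omega
    have e6 : k ≤ k + (d + 1) := by omega
    simp only [qBinomial, e1, e2, e3, e4, e5, e6, if_true]
    rw [qFactorial_succ q (k + (d + 1)), qFactorial_succ q k, qFactorial_succ q d]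
    have h1 := h k
    have h2 := h d
    have h3 := one_sub_pow_ne_zero hq k
    have h4 := one_sub_pow_ne_zero hq d
    field_simp
    ring

/-- The `q`-binomial theorem, with base `q = p ^ 2`. -/
lemma prod_one_add_mul_pow {p : ℂ} (hp : ‖p ^ 2‖ < 1) (x : ℂ) (n : ℕ) :
    ∏ k ∈ Finset.range n, (1 + x * (p ^ 2) ^ k) =
      ∑ k ∈ Finset.range (n + 1), p ^ (k * (k - 1)) * qBinomial (p ^ 2) n k * x ^ k := by
  induction n with
  | zero => simp [qBinomial_zero_right hp]
  | succ n ih =>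
    rw [Finset.prod_range_succ, ih, Finset.sum_range_succ' _ (n + 1)]
    have h1 : ∀ k ∈ Finset.range (n + 1),
        p ^ ((k + 1) * (k + 1 - 1)) * qBinomial (p ^ 2) (n + 1) (k + 1) * x ^ (k + 1) =
        p ^ ((k + 1) * (k + 1 - 1)) * qBinomial (p ^ 2) n (k + 1) * x ^ (k + 1) +
        p ^ (k * (k - 1)) * qBinomial (p ^ 2) n k * x ^ k * (x * (p ^ 2) ^ n) := by
      intro k hk
      have hk' : k ≤ n := Nat.lt_succ_iff.mp (Finset.mem_range.mp hk)
      rw [qBinomial_succ_succ hp hk', mul_add, add_mul]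
      congr 1
      have : p ^ ((k + 1) * (k + 1 - 1)) * (p ^ 2) ^ (n - k) =
          p ^ (k * (k - 1)) * (p ^ 2) ^ n := by
        rw [← pow_mul, ← pow_mul, ← pow_add, ← pow_add]
        congr 1
        obtain ⟨d, rfl⟩ := Nat.exists_eq_add_of_le hk'
        rcases k with _ | k
        · simp
        · simp only [Nat.add_sub_cancel, Nat.add_sub_cancel_left]
          ring
      rw [pow_succ x k]
      linear_combination (qBinomial (p ^ 2) n k * (x ^ k * x)) * this
    rw [Finset.sum_congr rfl h1, Finset.sum_add_distrib, ← Finset.sum_mul]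
    have h2 := Finset.sum_range_succ'
      (fun k => p ^ (k * (k - 1)) * qBinomial (p ^ 2) n k * x ^ k) (n + 1)
    rw [Finset.sum_range_succ, qBinomial_self_succ] at h2
    simp only [qBinomial_zero_right hp] at h2 ⊢
    linear_combination h2

/-- A finite form of the Jacobi triple product. -/
lemma finite_triple_product {p w : ℂ} (hp : ‖p ^ 2‖ < 1) (hp0 : p ≠ 0) (hw : w ≠ 0) (n : ℕ) :
    (∏ k ∈ Finset.range n, (1 - w * (p ^ 2) ^ (k + 1))) *
      (∏ k ∈ Finset.range n, (1 - w⁻¹ * (p ^ 2) ^ k)) =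
    ∑ k ∈ Finset.range (2 * n + 1), qBinomial (p ^ 2) (2 * n) k *
      ((-1) ^ ((k : ℤ) - n) * p ^ (((k : ℤ) - n) * ((k : ℤ) - n + 1)) * w ^ ((k : ℤ) - n)) := by
  have hneg : ∀ m : ℕ, ∏ k ∈ Finset.range m, (1 - w⁻¹ * (p ^ 2) ^ k) =
      (-1) ^ (m : ℤ) * p ^ ((m : ℤ) * (m - 1)) * w ^ (-(m : ℤ)) *
        ∏ k ∈ Finset.range m, (1 - w * (p ^ 2) ^ (-(k : ℤ))) := by
    intro m
    induction m with
    | zero => simp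
    | succ m ih =>
      rw [Finset.prod_range_succ, Finset.prod_range_succ, ih]
      have e1 : (((m + 1 : ℕ) : ℤ) * (((m + 1 : ℕ) : ℤ) - 1)) = (m : ℤ) * (m - 1) + 2 * m := by
        push_cast; ring
      have e2 : (-((m + 1 : ℕ) : ℤ)) = -(m : ℤ) + (-1) := by push_cast; ring
      have e3 : (1 - w⁻¹ * (p ^ 2) ^ m) =
          (-1) * p ^ (2 * (m : ℤ)) * w⁻¹ * (1 - w * (p ^ 2) ^ (-(m : ℤ))) := by
        have h1 : p ^ (2 * (m : ℤ)) = (p ^ 2) ^ m := by rw [zpow_mul]; norm_cast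
        have h2 : (p ^ 2) ^ m ≠ 0 := pow_ne_zero _ (pow_ne_zero _ hp0)
        rw [h1, zpow_neg, zpow_natCast]
        generalize (p ^ 2) ^ m = y at h2
        field_simp
        ring
      rw [e1, e2, e3, zpow_add₀ hp0, zpow_add₀ hw, Nat.cast_succ, zpow_add_one₀ (by norm_num),
        zpow_neg_one]
      ring
  have hG := prod_one_add_mul_pow hp (-w * (p ^ 2) ^ (1 - (n : ℤ))) (2 * n)
  have hsplit : ∏ k ∈ Finset.range (2 * n), (1 + -w * (p ^ 2) ^ (1 - (n : ℤ)) * (p ^ 2) ^ k) =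
      (∏ k ∈ Finset.range n, (1 - w * (p ^ 2) ^ (-(k : ℤ)))) *
        ∏ k ∈ Finset.range n, (1 - w * (p ^ 2) ^ (k + 1)) := by
    have hq0 : p ^ 2 ≠ 0 := pow_ne_zero _ hp0
    rw [two_mul, Finset.prod_range_add, ← Finset.prod_range_reflect]
    congr 1
    · refine Finset.prod_congr rfl fun k hk => ?_
      have := Finset.mem_range.mp hk
      rw [mul_assoc, ← zpow_natCast (p ^ 2) (n - 1 - k), ← zpow_add₀ hq0]
      have : (1 - (n : ℤ) + ((n - 1 - k : ℕ) : ℤ)) = -(k : ℤ) := by omega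
      rw [this]; ring
    · refine Finset.prod_congr rfl fun k hk => ?_
      rw [mul_assoc, ← zpow_natCast (p ^ 2) (n + k), ← zpow_add₀ hq0,
        ← zpow_natCast (p ^ 2) (k + 1)]
      have : (1 - (n : ℤ) + ((n + k : ℕ) : ℤ)) = ((k + 1 : ℕ) : ℤ) := by push_cast; ring
      rw [this]; ring
  rw [hneg n, mul_left_comm, mul_comm (∏ k ∈ Finset.range n, (1 - w * (p ^ 2) ^ (k + 1))),
    ← hsplit, hG, Finset.mul_sum]
  refine Finset.sum_congr rfl fun k _ => ?_
  have e1 : p ^ (k * (k - 1)) = p ^ ((k : ℤ) * (k - 1)) := by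
    rw [← zpow_natCast]
    congr 1
    rcases k with _ | k <;> simp
  have e2 : (p ^ 2) ^ (1 - (n : ℤ)) = p ^ (2 * (1 - (n : ℤ))) := by
    rw [zpow_mul]; norm_cast
  have e3 : (-1 : ℂ) ^ ((k : ℤ) - n) = (-1) ^ k * (-1) ^ (n : ℤ) := by
    rw [zpow_sub₀ (by norm_num), zpow_natCast, zpow_natCast, div_eq_mul_inv, ← inv_pow]
    norm_num
  have e4 : w ^ ((k : ℤ) - n) = w ^ k * w ^ (-(n : ℤ)) := by
    rw [sub_eq_add_neg, zpow_add₀ hw, zpow_natCast]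
  have e5 : p ^ (((k : ℤ) - n) * ((k : ℤ) - n + 1)) =
      p ^ ((n : ℤ) * (n - 1)) * p ^ ((k : ℤ) * (k - 1)) * p ^ (2 * (1 - (n : ℤ)) * k) := by
    rw [← zpow_add₀ hp0, ← zpow_add₀ hp0]
    congr 1
    ring
  rw [e1, e2, e3, e4, e5, mul_pow, ← zpow_natCast (p ^ (2 * (1 - (n : ℤ)))), ← zpow_mul,
    neg_pow w k]
  ring

lemma exists_exp_eq {p : ℂ} (hp0 : p ≠ 0) (hp : ‖p‖ < 1) :
    ∃ T : ℂ, 0 < T.im ∧ Complex.exp (π * I * T) = p := by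
  have hpi : (π : ℂ) ≠ 0 := by exact_mod_cast Real.pi_ne_zero
  refine ⟨((π⁻¹ : ℝ) : ℂ) * (-I * Complex.log p), ?_, ?_⟩
  · have h1 : (-I * Complex.log p).im = -Real.log ‖p‖ := by simp [Complex.log_re]
    rw [Complex.im_ofReal_mul, h1]
    exact mul_pos (inv_pos.mpr Real.pi_pos)
      (neg_pos.mpr (Real.log_neg (norm_pos_iff.mpr hp0) hp))
  · have h1 : π * I * (((π⁻¹ : ℝ) : ℂ) * (-I * Complex.log p)) = Complex.log p := by
      push_cast
      field_simp
      linear_combination (-Complex.log p) * Complex.I_sq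
    rw [h1, Complex.exp_log hp0]

lemma jacobiTheta₂_term_eq {p w T z : ℂ} (hT : Complex.exp (π * I * T) = p)
    (hz : Complex.exp (2 * π * I * z) = w) (j : ℤ) :
    jacobiTheta₂_term j z T = p ^ (j ^ 2) * w ^ j := by
  rw [jacobiTheta₂_term, ← hT, ← hz, ← Complex.exp_int_mul, ← Complex.exp_int_mul,
    ← Complex.exp_add]
  congr 1
  push_cast
  ring

lemma exists_exp_two_pi {w : ℂ} (hw : w ≠ 0) : ∃ z : ℂ, Complex.exp (2 * π * I * z) = w := by
  refine ⟨Complex.log w / (2 * π * I), ?_⟩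
  rw [mul_div_cancel₀ _ Complex.two_pi_I_ne_zero, Complex.exp_log hw]

lemma summable_theta {p w : ℂ} (hp0 : p ≠ 0) (hp : ‖p‖ < 1) (hw : w ≠ 0) :
    Summable fun j : ℤ => p ^ (j ^ 2) * w ^ j := by
  obtain ⟨T, hT, hTp⟩ := exists_exp_eq hp0 hp
  obtain ⟨z, hz⟩ := exists_exp_two_pi hw
  exact ((summable_jacobiTheta₂_term_iff z T).mpr hT).congr
    fun j => (jacobiTheta₂_term_eq hTp hz j)

lemma summable_int_mul_theta {p w : ℂ} (hp0 : p ≠ 0) (hp : ‖p‖ < 1) (hw : w ≠ 0) :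
    Summable fun j : ℤ => (j : ℂ) * (p ^ (j ^ 2) * w ^ j) := by
  obtain ⟨T, hT, hTp⟩ := exists_exp_eq hp0 hp
  obtain ⟨z, hz⟩ := exists_exp_two_pi hw
  refine (((summable_jacobiTheta₂'_term_iff z T).mpr hT).mul_left (2 * π * I)⁻¹).congr
    fun j => ?_
  rw [jacobiTheta₂'_term, jacobiTheta₂_term_eq hTp hz j]
  have := Complex.two_pi_I_ne_zero
  field_simp

lemma eulerProd_ne_zero {q : ℂ} (hq : ‖q‖ < 1) : eulerProd q ≠ 0 := by
  have h : ∏' n : ℕ, (1 + -q ^ (n + 1)) ≠ 0 := by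
    refine tprod_one_add_ne_zero_of_summable (f := fun n : ℕ ↦ -q ^ (n + 1)) ?_ ?_
    · intro n
      rw [← sub_eq_add_neg]
      exact one_sub_pow_ne_zero hq n
    · simpa using (summable_nat_add_iff 1).mpr (summable_geometric_of_lt_one (norm_nonneg _) hq)
  simpa only [eulerProd, sub_eq_add_neg] using h

lemma tendsto_qFactorial {q : ℂ} (hq : ‖q‖ < 1) :
    Tendsto (qFactorial q) atTop (𝓝 (eulerProd q)) :=
  (ModularForm.multipliable_one_sub_pow hq).tendsto_prod_tprod_nat

lemma exists_norm_qBinomial_le {q : ℂ} (hq : ‖q‖ < 1) :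
    ∃ C : ℝ, ∀ n k : ℕ, ‖qBinomial q n k‖ ≤ C := by
  obtain ⟨A, hA⟩ := (tendsto_qFactorial hq).norm.bddAbove_range
  obtain ⟨B, hB⟩ := ((tendsto_qFactorial hq).inv₀ (eulerProd_ne_zero hq)).norm.bddAbove_range
  have hA' : ∀ n, ‖qFactorial q n‖ ≤ A := fun n => hA ⟨n, rfl⟩
  have hB' : ∀ n, ‖(qFactorial q n)⁻¹‖ ≤ B := fun n => hB ⟨n, rfl⟩
  have hA0 : 0 ≤ A := (norm_nonneg _).trans (hA' 0)
  have hB0 : 0 ≤ B := (norm_nonneg _).trans (hB' 0)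
  refine ⟨A * (B * B), fun n k => ?_⟩
  unfold qBinomial
  split_ifs
  · rw [div_eq_mul_inv, mul_inv, norm_mul, norm_mul]
    exact mul_le_mul (hA' _) (mul_le_mul (hB' _) (hB' _) (norm_nonneg _) hB0) (by positivity) hA0
  · rw [norm_zero]; positivity

lemma multipliable_one_sub_mul_pow {q : ℂ} (hq : ‖q‖ < 1) (w : ℂ) (m : ℕ) :
    Multipliable fun n : ℕ ↦ 1 - w * q ^ (n + m) := by
  simp_rw [sub_eq_add_neg]
  apply multipliable_one_add_of_summable (f := fun n ↦ -(w * q ^ (n + m)))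
  simpa using ((summable_nat_add_iff m).mpr
    (summable_geometric_of_lt_one (norm_nonneg _) hq)).mul_left ‖w‖

lemma norm_sq_lt_one {p : ℂ} (hp : ‖p‖ < 1) : ‖p ^ 2‖ < 1 := by
  rw [norm_pow]
  exact pow_lt_one₀ (norm_nonneg _) hp two_ne_zero

/-- The Jacobi triple product identity. -/
theorem jacobi_triple_product {p w : ℂ} (hp0 : p ≠ 0) (hp : ‖p‖ < 1) (hw : w ≠ 0) :
    eulerProd (p ^ 2) * ((∏' k : ℕ, (1 - w * (p ^ 2) ^ (k + 1))) *
      ∏' k : ℕ, (1 - w⁻¹ * (p ^ 2) ^ k)) = ∑' j : ℤ, p ^ (j ^ 2) * (-(p * w)) ^ j := by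
  have hq := norm_sq_lt_one hp
  have hE := eulerProd_ne_zero hq
  set t : ℤ → ℂ := fun j => p ^ (j ^ 2) * (-(p * w)) ^ j with ht
  have hts : Summable t := summable_theta hp0 hp (neg_ne_zero.mpr (mul_ne_zero hp0 hw))
  let f : ℕ → ℤ → ℂ := fun n j =>
    if 0 ≤ j + n then qBinomial (p ^ 2) (2 * n) (j + n).toNat * t j else 0
  have hfin : ∀ n, (∏ k ∈ Finset.range n, (1 - w * (p ^ 2) ^ (k + 1))) *
      (∏ k ∈ Finset.range n, (1 - w⁻¹ * (p ^ 2) ^ k)) = ∑' j, f n j := by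
    intro n
    let e : ℕ ↪ ℤ := ⟨fun k => (k : ℤ) - n, fun a b h => by simpa using h⟩
    rw [finite_triple_product hq hp0 hw, tsum_eq_sum (s := (Finset.range (2 * n + 1)).map e),
      Finset.sum_map]
    · refine Finset.sum_congr rfl fun k _ => ?_
      have h1 : e k = (k : ℤ) - n := rfl
      have h2 : 0 ≤ e k + n := by rw [h1]; omega
      have h3 : (e k + n).toNat = k := by rw [h1]; omega
      simp only [f, h2, if_true, h3, ht]
      rw [← h1, neg_eq_neg_one_mul (p * w), mul_zpow, mul_zpow, mul_add, mul_one, zpow_add₀ hp0,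
        sq (e k)]
      ring
    · intro j hj
      simp only [f]
      split_ifs with h
      · have : ¬ (j + n).toNat ≤ 2 * n := by
          intro h'
          apply hj
          rw [Finset.mem_map]
          exact ⟨(j + n).toNat, Finset.mem_range.mpr (by omega), by
            change (((j + n).toNat : ℕ) : ℤ) - n = j
            omega⟩
        simp [qBinomial, this]
      · rfl
  obtain ⟨C, hC⟩ := exists_norm_qBinomial_le hq
  have hC0 : 0 ≤ C := (norm_nonneg _).trans (hC 0 0)
  have hlim : Tendsto (fun n => ∑' j, f n j) atTop (𝓝 (∑' j, (eulerProd (p ^ 2))⁻¹ * t j)) := by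
    refine tendsto_tsum_of_dominated_convergence (hts.norm.mul_left C) (fun j => ?_) ?_
    · have hP := tendsto_qFactorial hq
      have h1 : Tendsto (fun n : ℕ => 2 * n) atTop atTop :=
        tendsto_id.const_mul_atTop' two_pos
      have h2 : Tendsto (fun n : ℕ => (j + n).toNat) atTop atTop :=
        tendsto_atTop.mpr fun b => (eventually_ge_atTop (b + j.natAbs)).mono fun n hn => by omega
      have h3 : Tendsto (fun n : ℕ => 2 * n - (j + n).toNat) atTop atTop :=
        tendsto_atTop.mpr fun b => (eventually_ge_atTop (b + j.natAbs)).mono fun n hn => by omega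
      have h4 := ((hP.comp h1).div ((hP.comp h2).mul (hP.comp h3)) (mul_ne_zero hE hE)).mul_const
        (t j)
      have h5 : eulerProd (p ^ 2) / (eulerProd (p ^ 2) * eulerProd (p ^ 2)) =
          (eulerProd (p ^ 2))⁻¹ := by field_simp
      rw [h5] at h4
      refine h4.congr' ?_
      filter_upwards [eventually_ge_atTop j.natAbs] with n hn
      have h6 : 0 ≤ j + n := by omega
      have h7 : (j + n).toNat ≤ 2 * n := by omega
      simp only [f, h6, h7, qBinomial, if_true]
      rfl
    · refine Eventually.of_forall fun n j => ?_
      simp only [f]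
      split_ifs
      · rw [norm_mul]
        exact mul_le_mul_of_nonneg_right (hC _ _) (norm_nonneg _)
      · rw [norm_zero]; positivity
  have hlim' := ((multipliable_one_sub_mul_pow hq w 1).tendsto_prod_tprod_nat).mul
    ((multipliable_one_sub_mul_pow hq w⁻¹ 0).tendsto_prod_tprod_nat)
  have := tendsto_nhds_unique (hlim'.congr hfin) hlim
  simp only [add_zero] at this
  rw [this, tsum_mul_left, mul_inv_cancel_left₀ hE]

lemma eulerProd_eq_mul_prod_odd {x : ℂ} (hx : ‖x‖ < 1) :
    eulerProd x = eulerProd (x ^ 2) * ∏' k : ℕ, (1 - x * (x ^ 2) ^ k) := by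
  have hq := norm_sq_lt_one hx
  have h1 := (tendsto_qFactorial hq).mul
    ((multipliable_one_sub_mul_pow hq x 0).tendsto_prod_tprod_nat)
  have h2 := (tendsto_qFactorial hx).comp (tendsto_id.const_mul_atTop' (two_pos (α := ℕ)))
  refine tendsto_nhds_unique (h2.congr fun n => ?_) (by simpa only [add_zero] using h1)
  simp only [Function.comp_apply, id]
  induction n with
  | zero => simp [qFactorial_zero]
  | succ n ih =>
    rw [show 2 * (n + 1) = 2 * n + 1 + 1 by ring, qFactorial_succ, qFactorial_succ, qFactorial_succ,
      Finset.prod_range_succ, ih]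
    ring

/-- Gauss's identity `∏ (1 - q ^ n) / (1 + q ^ n) = ∑ (-1) ^ j * q ^ (j ^ 2)`. -/
lemma eulerProd_sq {x : ℂ} (hx0 : x ≠ 0) (hx : ‖x‖ < 1) :
    eulerProd x ^ 2 = eulerProd (x ^ 2) * ∑' j : ℤ, x ^ (j ^ 2) * (-1) ^ j := by
  have h := jacobi_triple_product hx0 hx (inv_ne_zero hx0)
  have e : ∀ k : ℕ, 1 - x⁻¹ * (x ^ 2) ^ (k + 1) = 1 - x * (x ^ 2) ^ k := fun k => by
    rw [pow_succ]; field_simp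
  simp only [e, inv_inv, mul_inv_cancel₀ hx0] at h
  rw [← h, eulerProd_eq_mul_prod_odd hx]
  ring

/-- Euler's pentagonal number theorem. -/
lemma eulerProd_sq_eq_tsum {x : ℂ} (hx0 : x ≠ 0) (hx : ‖x‖ < 1) :
    eulerProd (x ^ 2) = ∑' j : ℤ, (x ^ 3) ^ (j ^ 2) * (-x) ^ j := by
  have hx3 : ‖x ^ 3‖ < 1 := by
    rw [norm_pow]; exact pow_lt_one₀ (norm_nonneg _) hx three_ne_zero
  have h := jacobi_triple_product (pow_ne_zero 3 hx0) hx3 (inv_ne_zero (pow_ne_zero 2 hx0))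
  have e : x ^ 3 * (x ^ 2)⁻¹ = x := by field_simp
  rw [e, inv_inv] at h
  rw [← h]
  have hq := norm_sq_lt_one hx3
  have h1 := (tendsto_qFactorial hq).mul
    (((multipliable_one_sub_mul_pow hq (x ^ 2)⁻¹ 1).tendsto_prod_tprod_nat).mul
    ((multipliable_one_sub_mul_pow hq (x ^ 2) 0).tendsto_prod_tprod_nat))
  have h2 := (tendsto_qFactorial (norm_sq_lt_one hx)).comp
    (tendsto_id.const_mul_atTop' (three_pos (α := ℕ)))
  refine tendsto_nhds_unique (h2.congr fun n => ?_) (by simpa only [add_zero] using h1)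
  simp only [Function.comp_apply, id]
  induction n with
  | zero => simp [qFactorial_zero]
  | succ n ih =>
    rw [show 3 * (n + 1) = 3 * n + 1 + 1 + 1 by ring, qFactorial_succ, qFactorial_succ,
      qFactorial_succ, qFactorial_succ, Finset.prod_range_succ, Finset.prod_range_succ, ih]
    have e1 : (x ^ 2) ^ (3 * n + 1) = x ^ 2 * ((x ^ 3) ^ 2) ^ n := by ring
    have e2 : (x ^ 2) ^ (3 * n + 1 + 1) = (x ^ 2)⁻¹ * ((x ^ 3) ^ 2) ^ (n + 1) := by
      field_simp; ring
    have e3 : (x ^ 2) ^ (3 * n + 1 + 1 + 1) = ((x ^ 3) ^ 2) ^ (n + 1) := by ring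
    rw [e1, e2, e3]
    ring

lemma tprod_one_sub_mul_pow {q : ℂ} (hq : ‖q‖ < 1) (w : ℂ) :
    ∏' k : ℕ, (1 - w * q ^ k) = (1 - w) * ∏' k : ℕ, (1 - w * q ^ (k + 1)) := by
  have h := tprod_eq_zero_mul' (f := fun k : ℕ => 1 - w * q ^ k)
    (multipliable_one_sub_mul_pow hq w 1)
  rwa [pow_zero, mul_one] at h

lemma continuousAt_tprod_one_sub_mul_pow {q : ℂ} (hq : ‖q‖ < 1) :
    ContinuousAt (fun w : ℂ => ∏' k : ℕ, (1 - w * q ^ (k + 1))) 1 := by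
  have h : Tendsto (fun w : ℂ => ∏' k : ℕ, (1 + -(w * q ^ (k + 1)))) (𝓝 1)
      (𝓝 (∏' k : ℕ, (1 + -(1 * q ^ (k + 1))))) := by
    refine tendsto_tprod_one_add_of_dominated_convergence
      (bound := fun k : ℕ => 2 * ‖q‖ ^ (k + 1)) ?_ (fun k => ?_) ?_
    · exact ((summable_nat_add_iff 1).mpr
        (summable_geometric_of_lt_one (norm_nonneg _) hq)).mul_left 2
    · exact (Continuous.tendsto (by fun_prop) 1)
    · have : ∀ᶠ w : ℂ in 𝓝 1, ‖w‖ < 2 :=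
        (continuous_norm.tendsto (1 : ℂ)).eventually (gt_mem_nhds (by simp))
      filter_upwards [this] with w hw k
      rw [norm_neg, norm_mul, norm_pow]
      gcongr
  simpa only [ContinuousAt, sub_eq_add_neg] using h

lemma hasDerivAt_mul_of_eq_zero {u g : ℂ → ℂ} {u' z : ℂ} (hu : HasDerivAt u u' z) (h0 : u z = 0)
    (hg : ContinuousAt g z) : HasDerivAt (fun y => u y * g y) (u' * g z) z := by
  rw [hasDerivAt_iff_tendsto_slope] at hu ⊢
  refine (hu.mul (hg.tendsto.mono_left nhdsWithin_le_nhds)).congr fun y => ?_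
  simp only [slope, h0, vsub_eq_sub, smul_eq_mul, zero_mul, sub_zero]
  ring

/-- Jacobi's identity for the cube of Euler's product. -/
lemma two_mul_eulerProd_cube {x : ℂ} (hx0 : x ≠ 0) (hx : ‖x‖ < 1) :
    2 * eulerProd (x ^ 2) ^ 3 = ∑' j : ℤ, (2 * j + 1) * (x ^ (j ^ 2) * (-x) ^ j) := by
  have hq := norm_sq_lt_one hx
  obtain ⟨T, hT, hTp⟩ := exists_exp_eq hx0 hx
  obtain ⟨z₀, hz₀⟩ := exists_exp_two_pi (neg_ne_zero.mpr hx0)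
  let w : ℂ → ℂ := fun z => -Complex.exp (2 * π * I * z) / x
  have hw0 : ∀ z, w z ≠ 0 := fun z => div_ne_zero (neg_ne_zero.mpr (Complex.exp_ne_zero _)) hx0
  have hw1 : w z₀ = 1 := by simp only [w, hz₀, neg_neg, div_self hx0]
  have hwd : HasDerivAt w (2 * π * I) z₀ := by
    have h := ((((hasDerivAt_id z₀).const_mul (2 * π * I)).cexp).neg).div_const x
    simp only [id, hz₀, mul_one] at h
    have e : -(-x * (2 * π * I)) / x = 2 * π * I := by field_simp
    rw [e] at h
    exact h
  have hud : HasDerivAt (fun z => 1 - (w z)⁻¹) (2 * π * I) z₀ := by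
    have h := (hwd.inv (hw0 z₀)).const_sub 1
    simpa [hw1] using h
  let L : ℂ → ℂ := fun v => ∏' k : ℕ, (1 - v * (x ^ 2) ^ (k + 1))
  have hL : ContinuousAt L 1 := continuousAt_tprod_one_sub_mul_pow hq
  have hL1 : L 1 = eulerProd (x ^ 2) := by simp [L, eulerProd]
  have hth : ∀ z, jacobiTheta₂ z T =
      (1 - (w z)⁻¹) * (eulerProd (x ^ 2) * (L (w z) * L (w z)⁻¹)) := by
    intro z
    have h := jacobi_triple_product hx0 hx (hw0 z)
    have e : -(x * w z) = Complex.exp (2 * π * I * z) := by simp only [w]; field_simp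
    rw [e] at h
    have h1 : jacobiTheta₂ z T = ∑' j : ℤ, x ^ (j ^ 2) * Complex.exp (2 * π * I * z) ^ j :=
      tsum_congr fun j => jacobiTheta₂_term_eq hTp rfl j
    rw [h1, ← h, tprod_one_sub_mul_pow hq (w z)⁻¹]
    simp only [L]
    generalize ∏' k : ℕ, (1 - w z * (x ^ 2) ^ (k + 1)) = A
    generalize ∏' k : ℕ, (1 - (w z)⁻¹ * (x ^ 2) ^ (k + 1)) = B
    generalize eulerProd (x ^ 2) = C
    ring
  have hcont : ContinuousAt (fun z => eulerProd (x ^ 2) * (L (w z) * L (w z)⁻¹)) z₀ := by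
    have c1 : ContinuousAt (fun z => L (w z)) z₀ :=
      ContinuousAt.comp (g := L) (f := w) (by rwa [hw1]) hwd.continuousAt
    have c2 : ContinuousAt (fun z => L (w z)⁻¹) z₀ := by
      have hL' : ContinuousAt L (w z₀)⁻¹ := by rwa [hw1, inv_one]
      exact hL'.comp (f := fun z => (w z)⁻¹) (hwd.continuousAt.inv₀ (hw0 z₀))
    exact continuousAt_const.mul (c1.mul c2)
  have hd := hasDerivAt_mul_of_eq_zero hud (by simp [hw1]) hcont
  have hd' := hasDerivAt_jacobiTheta₂_fst z₀ hT
  have key : jacobiTheta₂' z₀ T = 2 * π * I * eulerProd (x ^ 2) ^ 3 := by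
    rw [hd'.unique (hd.congr_of_eventuallyEq (Eventually.of_forall hth)), hw1, inv_one, hL1]
    ring
  have hsum1 := (hasSum_jacobiTheta₂'_term z₀ hT).mul_left (2 * π * I)⁻¹
  have hsum2 := hasSum_jacobiTheta₂_term z₀ hT
  rw [key, inv_mul_cancel_left₀ Complex.two_pi_I_ne_zero] at hsum1
  rw [hth z₀, hw1, inv_one, sub_self, zero_mul] at hsum2
  have hsum := (hsum1.mul_left 2).add hsum2
  rw [add_zero] at hsum
  rw [← hsum.tsum_eq]
  refine tsum_congr fun j => ?_
  rw [jacobiTheta₂'_term, jacobiTheta₂_term_eq hTp hz₀ j]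
  have := Complex.two_pi_I_ne_zero
  field_simp

/-- Decomposition of `ℤ × ℤ` according to the residue class of `i + 2 * j` modulo `3`. -/
def latticeEquiv : Fin 3 × (ℤ × ℤ) ≃ ℤ × ℤ where
  toFun y := (y.2.1 - 2 * y.2.2 + ((y.1 : ℕ) - 1), y.2.1 + y.2.2)
  invFun x := (⟨((x.1 + 2 * x.2 + 1) % 3).toNat, by omega⟩,
    ((x.1 + 2 * x.2 + 1) / 3, x.2 - (x.1 + 2 * x.2 + 1) / 3))
  left_inv := by
    rintro ⟨⟨r, hr⟩, l, s⟩
    simp only [Prod.mk.injEq, Fin.mk.injEq]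
    refine ⟨?_, ?_, ?_⟩ <;> omega
  right_inv := by
    rintro ⟨i, j⟩
    simp only [Prod.mk.injEq]
    refine ⟨?_, ?_⟩ <;> omega

lemma tsum_prod_mul {u v : ℤ → ℂ} (h : Summable fun z : ℤ × ℤ => u z.1 * v z.2) :
    ∑' z : ℤ × ℤ, u z.1 * v z.2 = (∑' l, u l) * ∑' s, v s := by
  rw [h.tsum_prod]
  simp only [tsum_mul_left, tsum_mul_right]

lemma tsum_eq_sum_lattice {F : ℤ × ℤ → ℂ} (hF : Summable F) {u v : ℤ → ℤ → ℂ}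
    (h : ∀ r l s, F (l - 2 * s + r, l + s) = u r l * v r s) :
    ∑' z, F z = (∑' l, u (-1) l) * (∑' s, v (-1) s) + (∑' l, u 0 l) * (∑' s, v 0 s) +
      (∑' l, u 1 l) * ∑' s, v 1 s := by
  have h1 : Summable (F ∘ latticeEquiv) := latticeEquiv.summable_iff.mpr hF
  have h2 : ∑' z, F z = ∑ r : Fin 3, ∑' z : ℤ × ℤ, (F ∘ latticeEquiv) (r, z) :=
    (latticeEquiv.tsum_eq F).symm.trans (h1.tsum_prod.trans (tsum_fintype _))
  have h3 : ∀ r : Fin 3, ∑' z : ℤ × ℤ, (F ∘ latticeEquiv) (r, z) =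
      (∑' l, u ((r : ℕ) - 1) l) * ∑' s, v ((r : ℕ) - 1) s := by
    intro r
    have e : ∀ z : ℤ × ℤ, (F ∘ latticeEquiv) (r, z) =
        u ((r : ℕ) - 1) z.1 * v ((r : ℕ) - 1) z.2 := fun z => h _ _ _
    rw [tsum_congr e]
    exact tsum_prod_mul ((h1.prod_factor r).congr e)
  rw [h2, Fin.sum_univ_three, h3, h3, h3]
  norm_num

lemma tsum_eq_zero_of_antisymm {f : ℤ → ℂ} (e : ℤ ≃ ℤ) (h : ∀ j, f (e j) = -f j) :
    ∑' j, f j = 0 := by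
  have h1 := e.tsum_eq f
  simp only [h, tsum_neg] at h1
  exact self_eq_neg.mp h1.symm

lemma tsum_eq_neg_of_antisymm {f g : ℤ → ℂ} (e : ℤ ≃ ℤ) (h : ∀ j, f (e j) = -g j) :
    ∑' j, f j = -∑' j, g j := by
  rw [← e.tsum_eq f, tsum_congr h, tsum_neg]

lemma hasSum_mul_of_even {a b : ℤ → ℂ} (ha : Summable a)
    (ha' : Summable fun i : ℤ => (i : ℂ) * a i)
    (hb : Summable b) (hb' : Summable fun j : ℤ => (j : ℂ) * b j)
    (heven : ∀ j, b (-j) = b j) (c : ℂ) :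
    HasSum (fun z : ℤ × ℤ => (2 * z.1 + 1 + c * z.2) * (a z.1 * b z.2))
      ((∑' i : ℤ, (2 * i + 1) * a i) * ∑' j, b j) := by
  have ha2 : Summable fun i : ℤ => (2 * i + 1) * a i :=
    ((ha'.mul_left 2).add ha).congr fun i => by ring
  have h1 := (summable_mul_of_summable_norm ha2.norm hb.norm).hasSum
  have h2 := (summable_mul_of_summable_norm ha.norm hb'.norm).hasSum
  rw [← tsum_mul_tsum_of_summable_norm ha2.norm hb.norm] at h1
  rw [← tsum_mul_tsum_of_summable_norm ha.norm hb'.norm,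
    tsum_eq_zero_of_antisymm (f := fun j : ℤ => (j : ℂ) * b j) (Equiv.neg ℤ)
      (fun j => by simp [heven]), mul_zero] at h2
  have h3 := h1.add (h2.mul_left c)
  rw [mul_zero, add_zero] at h3
  have e : (fun z : ℤ × ℤ => (2 * z.1 + 1 + c * z.2) * (a z.1 * b z.2)) =
      fun z : ℤ × ℤ => (2 * z.1 + 1) * a z.1 * b z.2 + c * (a z.1 * (z.2 * b z.2)) := by
    funext z; ring
  rw [e]
  exact h3

lemma neg_one_zpow_congr {m n : ℤ} (h : Even (m - n)) : (-1 : ℂ) ^ m = (-1) ^ n := by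
  rw [← sub_add_cancel m n, zpow_add₀ (by norm_num), h.neg_one_zpow, one_mul]

lemma neg_one_zpow_congr_neg {m n : ℤ} (h : Odd (m - n)) : (-1 : ℂ) ^ m = -(-1) ^ n := by
  rw [← sub_add_cancel m n, zpow_add₀ (by norm_num), h.neg_one_zpow, neg_one_mul]

lemma pow_zpow_eq (x : ℂ) (n : ℕ) (m : ℤ) : (x ^ n) ^ m = x ^ ((n : ℤ) * m) := by
  rw [zpow_mul, zpow_natCast]

lemma neg_zpow_eq (x : ℂ) (m : ℤ) : (-x) ^ m = (-1) ^ m * x ^ m := by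
  rw [← mul_zpow, neg_one_mul]

lemma pow_mul_neg_zpow {x : ℂ} (hx0 : x ≠ 0) (m n : ℕ) (a j : ℤ) :
    (x ^ m) ^ a * (-x ^ n) ^ j = (-1) ^ j * x ^ (m * a + n * j) := by
  rw [neg_zpow_eq, pow_zpow_eq, pow_zpow_eq, zpow_add₀ hx0]
  ring

lemma eulerProd_four_eq {x : ℂ} (hx0 : x ≠ 0) (hx : ‖x‖ < 1) :
    eulerProd ((x ^ 2) ^ 2) = ∑' s : ℤ, (-1) ^ s * x ^ (6 * s ^ 2 + 2 * s) := by
  rw [eulerProd_sq_eq_tsum (pow_ne_zero 2 hx0) (norm_sq_lt_one hx)]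
  refine tsum_congr fun j => ?_
  rw [← pow_mul, pow_mul_neg_zpow hx0]
  norm_num

/-- The theta series `∑ (6 k + 1) q ^ (3 k ^ 2 + k)` as an eta quotient. -/
lemma tsum_six_mul_add_one {x : ℂ} (hx0 : x ≠ 0) (hx : ‖x‖ < 1) :
    (∑' k : ℤ, (6 * k + 1) * x ^ (3 * k ^ 2 + k)) * eulerProd ((x ^ 2) ^ 2) ^ 2 =
      eulerProd (x ^ 2) ^ 5 := by
  have hx2 : ‖x ^ 2‖ < 1 := norm_sq_lt_one hx
  have hx20 : x ^ 2 ≠ 0 := pow_ne_zero 2 hx0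
  have hs := hasSum_mul_of_even (summable_theta hx0 hx (neg_ne_zero.mpr hx0))
    (summable_int_mul_theta hx0 hx (neg_ne_zero.mpr hx0))
    (summable_theta hx20 hx2 (neg_ne_zero.mpr one_ne_zero))
    (summable_int_mul_theta hx20 hx2 (neg_ne_zero.mpr one_ne_zero))
    (fun j => by rw [neg_sq, zpow_neg, ← inv_zpow]; norm_num) 4
  have h4 := tsum_eq_sum_lattice hs.summable
    (u := fun r l => (6 * l + 2 * r + 1) * x ^ (3 * l ^ 2 + (2 * r + 1) * l + r * (r + 1)))
    (v := fun r s => (-1) ^ (r + s) * x ^ (6 * s ^ 2 - (4 * r + 2) * s))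
    (fun r l s => by
      have e1 : (-1 : ℂ) ^ (r + s) = (-1) ^ (l - 2 * s + r) * (-1) ^ (l + s) := by
        rw [← zpow_add₀ (by norm_num)]
        exact neg_one_zpow_congr ⟨s - l, by ring⟩
      have e2 : x ^ (3 * l ^ 2 + (2 * r + 1) * l + r * (r + 1)) *
          x ^ (6 * s ^ 2 - (4 * r + 2) * s) =
          x ^ ((l - 2 * s + r) ^ 2) * x ^ (l - 2 * s + r) * x ^ (2 * (l + s) ^ 2) := by
        rw [← zpow_add₀ hx0, ← zpow_add₀ hx0, ← zpow_add₀ hx0]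
        congr 1
        ring
      rw [e1, pow_zpow_eq, neg_zpow_eq]
      push_cast
      linear_combination (-(6 * l + 2 * r + 1) * ((-1) ^ (l - 2 * s + r) * (-1) ^ (l + s))) * e2)
  rw [hs.tsum_eq, ← two_mul_eulerProd_cube hx0 hx] at h4
  have hE := eulerProd_ne_zero (norm_sq_lt_one hx2)
  have h2 := eulerProd_sq hx20 hx2
  have h3 := eulerProd_four_eq hx0 hx
  have a1 := tsum_eq_neg_of_antisymm (Equiv.neg ℤ)
    (f := fun l : ℤ => (6 * l + 2 * (-1 : ℤ) + 1) *
      x ^ (3 * l ^ 2 + (2 * (-1) + 1) * l + -1 * (-1 + 1)))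
    (g := fun k : ℤ => (6 * k + 1) * x ^ (3 * k ^ 2 + k)) (fun l => by
      simp only [Equiv.neg_apply]
      rw [show 3 * (-l) ^ 2 + (2 * (-1) + 1) * -l + -1 * (-1 + 1) = 3 * l ^ 2 + l by ring]
      push_cast
      ring)
  have a2 := tsum_eq_neg_of_antisymm (Equiv.refl ℤ)
    (f := fun s : ℤ => (-1 : ℂ) ^ (-1 + s) * x ^ (6 * s ^ 2 - (4 * (-1) + 2) * s))
    (g := fun s : ℤ => (-1) ^ s * x ^ (6 * s ^ 2 + 2 * s)) (fun s => by
      simp only [Equiv.refl_apply]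
      rw [neg_one_zpow_congr_neg (m := -1 + s) (n := s) ⟨-1, by ring⟩,
        show 6 * s ^ 2 - (4 * (-1) + 2) * s = 6 * s ^ 2 + 2 * s by ring, neg_mul])
  have a3 : ∑' l : ℤ, (6 * l + 2 * (0 : ℤ) + 1) * x ^ (3 * l ^ 2 + (2 * 0 + 1) * l + 0 * (0 + 1)) =
      ∑' k : ℤ, (6 * k + 1) * x ^ (3 * k ^ 2 + k) := tsum_congr fun l => by simp
  have a4 : ∑' s : ℤ, (-1 : ℂ) ^ (0 + s) * x ^ (6 * s ^ 2 - (4 * 0 + 2) * s) =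
      ∑' s : ℤ, (-1) ^ s * x ^ (6 * s ^ 2 + 2 * s) := by
    rw [← (Equiv.neg ℤ).tsum_eq]
    refine tsum_congr fun s => ?_
    simp only [Equiv.neg_apply]
    rw [neg_one_zpow_congr (m := 0 + -s) (n := s) ⟨-s, by ring⟩,
      show 6 * (-s) ^ 2 - (4 * 0 + 2) * -s = 6 * s ^ 2 + 2 * s by ring]
  have a5 := tsum_eq_zero_of_antisymm (Equiv.subLeft 1)
    (f := fun s : ℤ => (-1 : ℂ) ^ (1 + s) * x ^ (6 * s ^ 2 - (4 * 1 + 2) * s)) (fun s => by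
      simp only [Equiv.subLeft_apply]
      rw [neg_one_zpow_congr_neg (m := 1 + (1 - s)) (n := 1 + s) ⟨-s, by ring⟩,
        show 6 * (1 - s) ^ 2 - (4 * 1 + 2) * (1 - s) = 6 * s ^ 2 - (4 * 1 + 2) * s by ring,
        neg_mul])
  rw [a1, a2, a3, a4, a5, ← h3] at h4
  apply mul_left_cancel₀ (mul_ne_zero two_ne_zero hE)
  linear_combination (-eulerProd ((x ^ 2) ^ 2) ^ 2) * h4 - 2 * eulerProd (x ^ 2) ^ 3 *
    eulerProd ((x ^ 2) ^ 2) * h2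

/-- The theta series `∑ (3 k + 1) q ^ (3 k ^ 2 + 2 k)` as an eta quotient. -/
lemma tsum_three_mul_add_one {x : ℂ} (hx0 : x ≠ 0) (hx : ‖x‖ < 1) :
    (∑' k : ℤ, (3 * k + 1) * x ^ (3 * k ^ 2 + 2 * k)) * eulerProd (x ^ 2) =
      (eulerProd x * eulerProd ((x ^ 2) ^ 2)) ^ 2 := by
  have hx2 : ‖x ^ 2‖ < 1 := norm_sq_lt_one hx
  have hx20 : x ^ 2 ≠ 0 := pow_ne_zero 2 hx0
  have hs := (Equiv.prodComm ℤ ℤ).hasSum_iff.mpr (hasSum_mul_of_even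
    (summable_theta hx20 hx2 (neg_ne_zero.mpr hx20))
    (summable_int_mul_theta hx20 hx2 (neg_ne_zero.mpr hx20))
    (summable_theta hx0 hx (neg_ne_zero.mpr one_ne_zero))
    (summable_int_mul_theta hx0 hx (neg_ne_zero.mpr one_ne_zero))
    (fun j => by rw [neg_sq, zpow_neg, ← inv_zpow]; norm_num) 1)
  have h4 := tsum_eq_sum_lattice hs.summable
    (u := fun r l => (3 * l + r + 1) * x ^ (3 * l ^ 2 + (2 * r + 2) * l + r ^ 2))
    (v := fun r s => (-1) ^ (r + s) * x ^ (6 * s ^ 2 + (2 - 4 * r) * s))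
    (fun r l s => by
      have e1 : (-1 : ℂ) ^ (r + s) = (-1) ^ (l - 2 * s + r) * (-1) ^ (l + s) := by
        rw [← zpow_add₀ (by norm_num)]
        exact neg_one_zpow_congr ⟨s - l, by ring⟩
      have e2 : x ^ (3 * l ^ 2 + (2 * r + 2) * l + r ^ 2) *
          x ^ (6 * s ^ 2 + (2 - 4 * r) * s) =
          x ^ (2 * (l + s) ^ 2) * x ^ (2 * (l + s)) * x ^ ((l - 2 * s + r) ^ 2) := by
        rw [← zpow_add₀ hx0, ← zpow_add₀ hx0, ← zpow_add₀ hx0]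
        congr 1
        ring
      simp only [Function.comp_apply, Equiv.prodComm_apply, Prod.swap_prod_mk]
      rw [e1, pow_zpow_eq, neg_zpow_eq, pow_zpow_eq]
      push_cast
      linear_combination (-(3 * l + r + 1) * ((-1) ^ (l - 2 * s + r) * (-1) ^ (l + s))) * e2)
  rw [hs.tsum_eq, ← two_mul_eulerProd_cube hx20 hx2] at h4
  have hE := eulerProd_ne_zero (norm_sq_lt_one hx2)
  have h2 := eulerProd_sq hx0 hx
  have h3 := eulerProd_four_eq hx0 hx
  have a1 := tsum_eq_neg_of_antisymm (Equiv.subLeft (-1))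
    (f := fun l : ℤ => (3 * l + (1 : ℤ) + 1) * x ^ (3 * l ^ 2 + (2 * 1 + 2) * l + 1 ^ 2))
    (g := fun k : ℤ => (3 * k + 1) * x ^ (3 * k ^ 2 + 2 * k)) (fun l => by
      simp only [Equiv.subLeft_apply]
      rw [show 3 * (-1 - l) ^ 2 + (2 * 1 + 2) * (-1 - l) + 1 ^ 2 = 3 * l ^ 2 + 2 * l by ring]
      push_cast
      ring)
  have a2 := tsum_eq_neg_of_antisymm (Equiv.neg ℤ)
    (f := fun s : ℤ => (-1 : ℂ) ^ (1 + s) * x ^ (6 * s ^ 2 + (2 - 4 * 1) * s))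
    (g := fun s : ℤ => (-1) ^ s * x ^ (6 * s ^ 2 + 2 * s)) (fun s => by
      simp only [Equiv.neg_apply]
      rw [neg_one_zpow_congr_neg (m := 1 + -s) (n := s) ⟨-s, by ring⟩,
        show 6 * (-s) ^ 2 + (2 - 4 * 1) * -s = 6 * s ^ 2 + 2 * s by ring, neg_mul])
  have a3 : ∑' l : ℤ, (3 * l + (0 : ℤ) + 1) * x ^ (3 * l ^ 2 + (2 * 0 + 2) * l + 0 ^ 2) =
      ∑' k : ℤ, (3 * k + 1) * x ^ (3 * k ^ 2 + 2 * k) := tsum_congr fun l => by simp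
  have a4 : ∑' s : ℤ, (-1 : ℂ) ^ (0 + s) * x ^ (6 * s ^ 2 + (2 - 4 * 0) * s) =
      ∑' s : ℤ, (-1) ^ s * x ^ (6 * s ^ 2 + 2 * s) := tsum_congr fun s => by simp
  have a5 := tsum_eq_zero_of_antisymm (Equiv.subLeft (-1))
    (f := fun s : ℤ => (-1 : ℂ) ^ (-1 + s) * x ^ (6 * s ^ 2 + (2 - 4 * -1) * s)) (fun s => by
      simp only [Equiv.subLeft_apply]
      rw [neg_one_zpow_congr_neg (m := -1 + (-1 - s)) (n := -1 + s) ⟨-s - 1, by ring⟩,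
        show 6 * (-1 - s) ^ 2 + (2 - 4 * -1) * (-1 - s) = 6 * s ^ 2 + (2 - 4 * -1) * s by ring,
        neg_mul])
  rw [a1, a2, a3, a4, a5, ← h3] at h4
  apply mul_left_cancel₀ (mul_ne_zero two_ne_zero hE)
  linear_combination (-eulerProd (x ^ 2)) * h4 - 2 * eulerProd ((x ^ 2) ^ 2) ^ 3 * h2

lemma intCast_zmod_six_eq_iff (n : ℤ) (k : ℕ) :
    (n : ZMod (2 * 3)) = (k : ZMod (2 * 3)) ↔ n % 6 = k % 6 := by
  rw [← Int.cast_natCast k, ZMod.intCast_eq_intCast_iff']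
  norm_num

lemma chi_three_eq {a : ℕ} (ha : a ≤ 1) (n : ℤ) :
    chi 3 a n = if n % 6 = 2 - a then 1 else if n % 6 = 4 + a then -1 else 0 := by
  unfold chi
  simp only [intCast_zmod_six_eq_iff]
  have h1 : ((3 - 1 - a : ℕ) : ℤ) % 6 = 2 - a := by omega
  have h2 : ((3 + 1 + a : ℕ) : ℤ) % 6 = 4 + a := by omega
  rw [h1, h2]

lemma Phi_three_eq {a : ℕ} (ha : a ≤ 1) {τ : ℂ} {S : ℂ}
    (h : HasSum (fun k : ℤ => ((6 * k + (2 - a) : ℤ) : ℂ) *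
      Complex.exp (π * I * ((6 * k + (2 - a) : ℤ) : ℂ) ^ 2 * τ / 6)) S) :
    Phi 3 a τ = 2 * S := by
  let g : ℤ ⊕ ℤ → ℤ := Sum.elim (fun k => 6 * k + (2 - a)) (fun k => -(6 * k + (2 - a)))
  have hg : Function.Injective g := by
    rintro (k | k) (l | l) hkl <;> simp only [g, Sum.elim_inl, Sum.elim_inr] at hkl
    · congr 1; omega
    · omega
    · omega
    · congr 1; omega
  let f : ℤ → ℂ := fun n =>
    (n : ℂ) * chi 3 a n * Complex.exp ((π : ℂ) * I * (n : ℂ) ^ 2 * τ / (2 * (3 : ℕ)))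
  have hsupp : ∀ n ∉ Set.range g, f n = 0 := by
    intro n hn
    have h1 : ¬ n % 6 = 2 - a := fun h1 => hn ⟨Sum.inl ((n - (2 - a)) / 6), by
      simp only [g, Sum.elim_inl]; omega⟩
    have h2 : ¬ n % 6 = 4 + a := fun h2 => hn ⟨Sum.inr ((-n - (2 - a)) / 6), by
      simp only [g, Sum.elim_inr]; omega⟩
    simp [f, chi_three_eq ha, h1, h2]
  have hl : HasSum ((f ∘ g) ∘ Sum.inl) S := by
    convert h using 1
    funext k
    have h1 : (6 * k + (2 - a)) % 6 = 2 - (a : ℤ) := by omega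
    simp only [Function.comp_apply, g, Sum.elim_inl, f, chi_three_eq ha, h1, if_true]
    norm_num
  have hr : HasSum ((f ∘ g) ∘ Sum.inr) S := by
    convert h using 1
    funext k
    have h1 : ¬ 4 + (a : ℤ) = 2 - a := by omega
    have h2 : (-(6 * k + (2 - a))) % 6 = 4 + (a : ℤ) := by omega
    simp only [Function.comp_apply, g, Sum.elim_inr, f, chi_three_eq ha, h2, if_neg h1, if_true]
    push_cast
    rw [neg_sq]
    norm_num
  have := (hg.hasSum_iff hsupp).mp (hl.sum hr)
  rw [two_mul]
  exact this.tsum_eq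

lemma dedekindEta_natCast_mul (n : ℕ) (τ : ℂ) :
    dedekindEta (n * τ) = Complex.exp (π * I * τ / 12) ^ n *
      eulerProd (Complex.exp (2 * π * I * τ) ^ n) := by
  rw [dedekindEta, eulerProd, ← Complex.exp_nat_mul, ← Complex.exp_nat_mul]
  congr 2
  · ring
  · ext k; congr 3; ring

/-- for `τ` in the upper half-plane, with
`Φ_3^{(a)}(τ) = Σ_{n∈ℤ} n χ_6^{(a)}(n) e^{πin²τ/6}` (`a = 0, 1`), the eta-product
identities `Φ_3^{(0)}(τ) = 4 (η(τ) η(4τ))²/η(2τ)` and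
`Φ_3^{(1)}(τ) = 2 η(2τ)⁵/η(4τ)²` hold. -/
theorem stmt19 (τ : ℂ) (hτ : 0 < τ.im) :
    Phi 3 0 τ = 4 * (dedekindEta τ * dedekindEta (4 * τ)) ^ 2 / dedekindEta (2 * τ) ∧
      Phi 3 1 τ = 2 * (dedekindEta (2 * τ)) ^ 5 / (dedekindEta (4 * τ)) ^ 2 := by
  set x := Complex.exp (2 * π * I * τ)
  set y := Complex.exp (π * I * τ / 12)
  have hx0 : x ≠ 0 := Complex.exp_ne_zero _
  have hy0 : y ≠ 0 := Complex.exp_ne_zero _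
  have hx : ‖x‖ < 1 := UpperHalfPlane.norm_exp_two_pi_I_lt_one ⟨τ, hτ⟩
  have hx3 : ‖x ^ 3‖ < 1 := by
    rw [norm_pow]; exact pow_lt_one₀ (norm_nonneg _) hx three_ne_zero
  have hx30 : x ^ 3 ≠ 0 := pow_ne_zero 3 hx0
  have hE2 := eulerProd_ne_zero (norm_sq_lt_one hx)
  have hE4 := eulerProd_ne_zero (norm_sq_lt_one (norm_sq_lt_one hx))
  have eta1 : dedekindEta τ = y * eulerProd x := by
    simpa using dedekindEta_natCast_mul 1 τ
  have eta2 : dedekindEta (2 * τ) = y ^ 2 * eulerProd (x ^ 2) := by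
    simpa using dedekindEta_natCast_mul 2 τ
  have eta4 : dedekindEta (4 * τ) = y ^ 4 * eulerProd ((x ^ 2) ^ 2) := by
    rw [← pow_mul]; simpa using dedekindEta_natCast_mul 4 τ
  have hsum : ∀ (b : ℕ) (c d : ℂ),
      Summable fun k : ℤ => (c * k + d) * x ^ (3 * k ^ 2 + b * k) := by
    intro b c d
    have hxb : x ^ b ≠ 0 := pow_ne_zero b hx0
    refine (((summable_int_mul_theta hx30 hx3 hxb).mul_left c).add
      ((summable_theta hx30 hx3 hxb).mul_left d)).congr fun k => ?_
    rw [pow_zpow_eq, pow_zpow_eq, zpow_add₀ hx0]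
    push_cast
    ring
  have hy : ∀ m : ℕ, y ^ m = Complex.exp (m * (π * I * τ / 12)) := fun m =>
    (Complex.exp_nat_mul _ _).symm
  have hxz : ∀ m : ℤ, x ^ m = Complex.exp (m * (2 * π * I * τ)) := fun m =>
    (Complex.exp_int_mul _ _).symm
  constructor
  · have h : HasSum (fun k : ℤ => ((6 * k + (2 - (0 : ℕ)) : ℤ) : ℂ) *
        Complex.exp (π * I * ((6 * k + (2 - (0 : ℕ)) : ℤ) : ℂ) ^ 2 * τ / 6))
        (2 * y ^ 8 * ∑' k : ℤ, (3 * k + 1) * x ^ (3 * k ^ 2 + 2 * k)) := by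
      refine (congrArg (HasSum · _) (funext fun k => ?_)).mpr
        ((hsum 2 3 1).hasSum.mul_left (2 * y ^ 8))
      have e : Complex.exp (π * I * ((6 * k + (2 - (0 : ℕ)) : ℤ) : ℂ) ^ 2 * τ / 6) =
          y ^ 8 * x ^ (3 * k ^ 2 + (2 : ℕ) * k) := by
        rw [hy, hxz, ← Complex.exp_add]
        congr 1
        push_cast
        ring
      rw [e]
      push_cast
      ring
    rw [Phi_three_eq (by norm_num) h, eta1, eta2, eta4,
      eq_div_iff (mul_ne_zero (pow_ne_zero _ hy0) hE2)]
    linear_combination 4 * y ^ 10 * tsum_three_mul_add_one hx0 hx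
  · have h : HasSum (fun k : ℤ => ((6 * k + (2 - (1 : ℕ)) : ℤ) : ℂ) *
        Complex.exp (π * I * ((6 * k + (2 - (1 : ℕ)) : ℤ) : ℂ) ^ 2 * τ / 6))
        (y ^ 2 * ∑' k : ℤ, (6 * k + 1) * x ^ (3 * k ^ 2 + k)) := by
      have hs := (hsum 1 6 1).hasSum.mul_left (y ^ 2)
      simp only [Nat.cast_one, one_mul] at hs
      refine (congrArg (HasSum · _) (funext fun k => ?_)).mpr hs
      have e : Complex.exp (π * I * ((6 * k + (2 - (1 : ℕ)) : ℤ) : ℂ) ^ 2 * τ / 6) =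
          y ^ 2 * x ^ (3 * k ^ 2 + k) := by
        rw [hy, hxz, ← Complex.exp_add]
        congr 1
        push_cast
        ring
      rw [e]
      push_cast
      ring
    rw [Phi_three_eq le_rfl h, eta2, eta4,
      eq_div_iff (pow_ne_zero 2 (mul_ne_zero (pow_ne_zero _ hy0) hE4))]
    linear_combination 2 * y ^ 10 * tsum_six_mul_add_one hx0 hx
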